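/- For every v ∈ ℝ⁶ and every symmetric 6×6 real matrix I, the Niemeyer–Slotine body-level factorization satisfies B(v, I) + B(v, I)ᵀ = (v×*) I − I (v×). Together with the property B(v, I) v = (v×*)(I v), this makes B an admissible body-level factorization. -/

import Mathlib

open Matrix BigOperators

/-- The 3×3 skew-symmetric cross-product matrix `S(p)` with `S(p) x = p × x`. -/
def skew3 (p : Fin 3 → ℝ) : Matrix (Fin 3) (Fin 3) ℝ :=
  !![0, -p 2, p 1; p 2, 0, -p 0; -p 1, p 0, 0]

/-- Spatial vectors `ℝ⁶ ≅ ℝ³ × ℝ³`, indexed by `Fin 3 ⊕ Fin 3`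
(first block: angular part `ω` / moment `n`, second block: linear part `u` / force `F`). -/
abbrev SpatialVec := Fin 3 ⊕ Fin 3 → ℝ

/-- The spatial motion/motion cross-product matrix `(v×) = [[S(ω), 0],[S(u), S(ω)]]`. -/
def crossM (v : SpatialVec) : Matrix (Fin 3 ⊕ Fin 3) (Fin 3 ⊕ Fin 3) ℝ :=
  Matrix.fromBlocks (skew3 (v ∘ Sum.inl)) 0 (skew3 (v ∘ Sum.inr)) (skew3 (v ∘ Sum.inl))

/-- The spatial motion/force cross-product matrix `(v×*) = −(v×)ᵀ`. -/
def crossF (v : SpatialVec) : Matrix (Fin 3 ⊕ Fin 3) (Fin 3 ⊕ Fin 3) ℝ :=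
  -(crossM v)ᵀ

/-- The swapped cross-product matrix `(f ×̄*) = [[−S(n), −S(F)],[−S(F), 0]]`. -/
def crossBar (f : SpatialVec) : Matrix (Fin 3 ⊕ Fin 3) (Fin 3 ⊕ Fin 3) ℝ :=
  Matrix.fromBlocks (-skew3 (f ∘ Sum.inl)) (-skew3 (f ∘ Sum.inr))
    (-skew3 (f ∘ Sum.inr)) 0

/-- The Niemeyer–Slotine body-level factorization
`B(v, I) = (1/2)[(v×*) I + ((I v) ×̄*) − I (v×)]`. -/
noncomputable def nsB (v : SpatialVec) (I : Matrix (Fin 3 ⊕ Fin 3) (Fin 3 ⊕ Fin 3) ℝ) :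
    Matrix (Fin 3 ⊕ Fin 3) (Fin 3 ⊕ Fin 3) ℝ :=
  (1 / 2 : ℝ) • (crossF v * I + crossBar (I *ᵥ v) - I * crossM v)

theorem crossBar_transpose (f : SpatialVec) : (crossBar f)ᵀ = -crossBar f := by
  ext i j
  rcases i with i | i <;> rcases j with j | j <;> fin_cases i <;> fin_cases j <;>
    simp [crossBar, skew3]

theorem crossM_self (v : SpatialVec) : crossM v *ᵥ v = 0 := by
  ext i
  rcases i with i | i <;> fin_cases i <;>
    simp [crossM, skew3, Matrix.mulVec, dotProduct, Fin.sum_univ_three] <;> ring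

theorem crossBar_mulVec (f v : SpatialVec) : crossBar f *ᵥ v = crossF v *ᵥ f := by
  ext i
  rcases i with i | i <;> fin_cases i <;>
    simp [crossM, crossF, crossBar, skew3, Matrix.mulVec, dotProduct, Fin.sum_univ_three] <;> ring

/-- For symmetric `I`, the Niemeyer–Slotine factorization satisfies
`B(v,I) + B(v,I)ᵀ = (v×*) I − I (v×)`; together with `B(v,I) v = (v×*)(I v)`
this makes `B` an admissible body-level factorization. -/
theorem nsB_admissible (v : SpatialVec) (I : Matrix (Fin 3 ⊕ Fin 3) (Fin 3 ⊕ Fin 3) ℝ)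
    (hI : I.IsSymm) :
    nsB v I + (nsB v I)ᵀ = crossF v * I - I * crossM v ∧
    nsB v I *ᵥ v = crossF v *ᵥ (I *ᵥ v) := by
  have hI' : Iᵀ = I := hI
  constructor
  · have h1 : (crossF v * I)ᵀ = -(I * crossM v) := by
      simp [crossF, Matrix.transpose_mul, hI']
    have h2 : (I * crossM v)ᵀ = -(crossF v * I) := by
      simp [crossF, Matrix.transpose_mul, hI']
    unfold nsB
    rw [Matrix.transpose_smul, Matrix.transpose_sub, Matrix.transpose_add, h1, h2,
      crossBar_transpose]
    module
  · unfold nsB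
    rw [Matrix.smul_mulVec, Matrix.sub_mulVec, Matrix.add_mulVec, crossBar_mulVec,
      ← Matrix.mulVec_mulVec, ← Matrix.mulVec_mulVec, crossM_self, Matrix.mulVec_zero]
    module
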